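/- (Firewall decrease up to pollution term, laboratory frame.) There exist positive quantities ν and K, depending only on V and on R, such that the following holds: for every radially symmetric solution u with sup over r,t of |u(r,t)| ≤ R, for every ρ ≥ r_sc and every t > 0, the function t ↦ F₀(ρ,t) is differentiable and ∂_t F₀(ρ,t) ≤ −ν F₀(ρ,t) + K ∫_{Σ₀(t)} T_ρψ₀(r) dr. -/

import Mathlib

open Filter Topology Set MeasureTheory

noncomputable section

local notation "⟪" x ", " y "⟫" => @inner ℝ _ _ x y

abbrev Euc (n : ℕ) : Type := EuclideanSpace ℝ (Fin n)

variable {n : ℕ}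

/-- Spatial partial derivative `u_r`. -/
def ur (u : ℝ → ℝ → Euc n) (r t : ℝ) : Euc n := deriv (fun s => u s t) r

/-- Second spatial partial derivative `u_rr`. -/
def urr (u : ℝ → ℝ → Euc n) (r t : ℝ) : Euc n := deriv (fun s => ur u s t) r

/-- Time partial derivative `u_t`. -/
def ut (u : ℝ → ℝ → Euc n) (r t : ℝ) : Euc n := deriv (fun s => u r s) t

/-- Hessian (second differential) of the potential. -/
def hess (V : Euc n → ℝ) (x : Euc n) : Euc n →L[ℝ] Euc n := fderiv ℝ (gradient V) x

/-- Coercivity hypothesis. -/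
def HCoerc (V : Euc n → ℝ) : Prop :=
  ∃ ε > (0:ℝ), ∃ R : ℝ, ∀ x : Euc n, R ≤ ‖x‖ → ε * ‖x‖ ^ 2 ≤ ⟪x, gradient V x⟫

/-- The set of nondegenerate minimum points of `V`. -/
def MinSet (V : Euc n → ℝ) : Set (Euc n) :=
  {m | gradient V m = 0 ∧ ∀ v : Euc n, v ≠ 0 → 0 < ⟪v, hess V m v⟫}

/-- Data of the constants `λ_min`, `λ_max`, `d_Esc` from the paper, together with their
spectral characterizations. -/
structure EscData (n : ℕ) (V : Euc n → ℝ) where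
  lmin : ℝ
  lmax : ℝ
  dEsc : ℝ
  lmin_pos : 0 < lmin
  dEsc_pos : 0 < dEsc
  lower : ∀ m ∈ MinSet V, ∀ v : Euc n, lmin * ‖v‖ ^ 2 ≤ ⟪v, hess V m v⟫
  upper : ∀ m ∈ MinSet V, ∀ v : Euc n, ⟪v, hess V m v⟫ ≤ lmax * ‖v‖ ^ 2
  esc_lower : ∀ m ∈ MinSet V, ∀ x : Euc n, ‖x - m‖ ≤ dEsc →
    ∀ v : Euc n, lmin / 2 * ‖v‖ ^ 2 ≤ ⟪v, hess V x v⟫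
  esc_upper : ∀ m ∈ MinSet V, ∀ x : Euc n, ‖x - m‖ ≤ dEsc →
    ∀ v : Euc n, ⟪v, hess V x v⟫ ≤ 2 * lmax * ‖v‖ ^ 2

/-- Radially symmetric solution of `u_t = -∇V(u) + ((d-1)/r) u_r + u_rr` with Neumann
boundary condition at the origin. -/
structure IsRadialSolution (d : ℕ) (V : Euc n → ℝ) (u : ℝ → ℝ → Euc n) : Prop where
  diff_r : ∀ t > (0:ℝ), ∀ r : ℝ, DifferentiableAt ℝ (fun s => u s t) r
  diff_rr : ∀ t > (0:ℝ), ∀ r : ℝ, DifferentiableAt ℝ (fun s => ur u s t) r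
  cont_rr : ∀ t > (0:ℝ), Continuous fun r => urr u r t
  diff_t : ∀ t > (0:ℝ), ∀ r : ℝ, DifferentiableAt ℝ (fun s => u r s) t
  cont_t : ∀ r : ℝ, ContinuousOn (fun s => ut u r s) (Ioi 0)
  bounded : ∃ C : ℝ, ∀ r t : ℝ, 0 ≤ r → 0 < t →
    ‖u r t‖ + ‖ur u r t‖ + ‖urr u r t‖ + ‖ut u r t‖ ≤ C
  pde : ∀ r > (0:ℝ), ∀ t > (0:ℝ),
    ut u r t = -gradient V (u r t) + (((d : ℝ) - 1) / r) • ur u r t + urr u r t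
  neumann : ∀ t > (0:ℝ), ur u 0 t = 0

/-- Profiles of fronts travelling at speed `c` connecting `um` to `up`
(nonconstant solutions of `φ'' = -cφ' + ∇V(φ)`). -/
def Phi (V : Euc n → ℝ) (c : ℝ) (um up : Euc n) : Set (ℝ → Euc n) :=
  {φ | (∃ ξ₁ ξ₂ : ℝ, φ ξ₁ ≠ φ ξ₂) ∧
    (∀ ξ : ℝ, DifferentiableAt ℝ φ ξ) ∧ (∀ ξ : ℝ, DifferentiableAt ℝ (deriv φ) ξ) ∧
    (∀ ξ : ℝ, deriv (deriv φ) ξ = -(c • deriv φ ξ) + gradient V (φ ξ)) ∧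
    Tendsto φ atBot (𝓝 um) ∧ Tendsto φ atTop (𝓝 up)}

/-- Fronts travelling at speed `c` invading the equilibrium `mp`. -/
def PhiInv (V : Euc n → ℝ) (c : ℝ) (mp : Euc n) : Set (ℝ → Euc n) :=
  ⋃ mm ∈ MinSet V, Phi V c mm mp

/-- Normalized front profiles. -/
def PhiNorm (V : Euc n → ℝ) (dEsc c : ℝ) (mm mp : Euc n) : Set (ℝ → Euc n) :=
  {φ | φ ∈ Phi V c mm mp ∧ ‖φ 0 - mp‖ = dEsc ∧ ∀ ξ > (0:ℝ), ‖φ ξ - mp‖ < dEsc}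

/-- Normalized front profiles invading `mp`. -/
def PhiNormInv (V : Euc n → ℝ) (dEsc c : ℝ) (mp : Euc n) : Set (ℝ → Euc n) :=
  ⋃ mm ∈ MinSet V, PhiNorm V dEsc c mm mp

/-- Every critical point of `V` is nondegenerate. -/
def HNonDeg (V : Euc n → ℝ) : Prop :=
  ∀ x : Euc n, gradient V x = 0 → ∀ v : Euc n, hess V x v = 0 → v = 0

/-- Every front travelling at a positive speed and invading a minimum point is bistable. -/
def HOnlyBist (V : Euc n → ℝ) : Prop :=
  ∀ mp ∈ MinSet V, ∀ um : Euc n, gradient V um = 0 →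
    ∀ c > (0:ℝ), (Phi V c um mp).Nonempty → um ∈ MinSet V

/-- The set of invading speeds has empty interior. -/
def HDiscVel (V : Euc n → ℝ) : Prop :=
  ∀ mp ∈ MinSet V, interior {c : ℝ | 0 ≤ c ∧ (PhiInv V c mp).Nonempty} = ∅

/-- The set of initial values of normalized invading fronts is totally disconnected. -/
def HDiscFront (V : Euc n → ℝ) (dEsc : ℝ) : Prop :=
  ∀ mp ∈ MinSet V, ∀ c > (0:ℝ),
    IsTotallyDisconnected
      {p : Euc n × Euc n | ∃ φ ∈ PhiNormInv V dEsc c mp, p = (φ 0, deriv φ 0)}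

/-- The generic hypotheses on the potential. -/
def HGen (V : Euc n → ℝ) (dEsc : ℝ) : Prop :=
  HNonDeg V ∧ HOnlyBist V ∧ HDiscVel V ∧ HDiscFront V dEsc

/-- The solution is stable at infinity, close to the minimum point `m`. -/
def StableAtInfinity (V : Euc n → ℝ) (u : ℝ → ℝ → Euc n) (m : Euc n) : Prop :=
  m ∈ MinSet V ∧
    Tendsto (fun t => limsup (fun r => ‖u r t - m‖) atTop) atTop (𝓝 0)

/-- Propagating terrace of bistable fronts connecting `mLoc` to `mFar`. -/
def IsTerrace (V : Euc n → ℝ) (mLoc mFar : Euc n) (T : ℝ → ℝ → Euc n) : Prop :=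
  ∃ (q : ℕ) (ms : ℕ → Euc n) (cs : ℕ → ℝ) (φs : ℕ → ℝ → Euc n) (rs : ℕ → ℝ → ℝ),
    ms 0 = mFar ∧ ms q = mLoc ∧ (∀ i, i ≤ q → ms i ∈ MinSet V) ∧
    (∀ i, i < q → V (ms (i + 1)) < V (ms i)) ∧
    (∀ i, 1 ≤ i → i ≤ q → 0 < cs i) ∧
    (∀ i, 1 ≤ i → i + 1 ≤ q → cs (i + 1) ≤ cs i) ∧
    (∀ i, 1 ≤ i → i ≤ q → φs i ∈ Phi V (cs i) (ms i) (ms (i - 1))) ∧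
    (∀ i, 1 ≤ i → i ≤ q →
      (∀ t : ℝ, 0 ≤ t → 0 ≤ rs i t) ∧ (∀ t : ℝ, DifferentiableAt ℝ (rs i) t) ∧
        Tendsto (deriv (rs i)) atTop (𝓝 (cs i))) ∧
    (∀ i, 1 ≤ i → i + 1 ≤ q → Tendsto (fun t => rs (i + 1) t - rs i t) atTop atTop) ∧
    (∀ r t : ℝ, 0 ≤ r → 0 ≤ t →
      T r t = ms 0 + ∑ i ∈ Finset.Icc 1 q, (φs i (r - rs i t) - ms (i - 1)))

/-- Hypothesis `(H_hom)` unbundled: `u` is close to `m` on a growing interval around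
`rHom t`, travelling at asymptotic speed `cHom`; closeness is measured in `H¹` norm. -/
def HHomWith (u : ℝ → ℝ → Euc n) (m : Euc n) (cHom : ℝ) (rHom : ℝ → ℝ) : Prop :=
  0 < cHom ∧ (∀ t : ℝ, DifferentiableAt ℝ rHom t) ∧
    Tendsto (deriv rHom) atTop (𝓝 cHom) ∧
    ∀ L > (0:ℝ),
      Tendsto
        (fun t => ∫ r in (-L)..L,
          (‖u (rHom t + r) t - m‖ ^ 2 + ‖ur u (rHom t + r) t‖ ^ 2))
        atTop (𝓝 0)

/-- The set whose supremum defines the Escape point `r_Esc(t)`. -/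
def rEscSet (u : ℝ → ℝ → Euc n) (m : Euc n) (dEsc : ℝ) (rHom : ℝ → ℝ) (t : ℝ) : Set ℝ :=
  {r | r ∈ Icc 0 (rHom t) ∧ ‖u r t - m‖ = dEsc}

/-- The Escape point `r_Esc(t)`. -/
def rEscF (u : ℝ → ℝ → Euc n) (m : Euc n) (dEsc : ℝ) (rHom : ℝ → ℝ) (t : ℝ) : ℝ :=
  sSup (rEscSet u m dEsc rHom t)

/-- The upper limit mean speed `c_Esc` of the Escape point. -/
def cEscV (u : ℝ → ℝ → Euc n) (m : Euc n) (dEsc : ℝ) (rHom : ℝ → ℝ) : ℝ :=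
  limsup (fun t => rEscF u m dEsc rHom t / t) atTop

/-- `q_hull`: minimal convexity of the lower quadratic hulls of `V` at minimum points. -/
def qHull (V : Euc n → ℝ) : ℝ :=
  sInf {q : ℝ | ∃ m ∈ MinSet V, ∃ x : Euc n, x ≠ m ∧ q = (V x - V m) / ‖x - m‖ ^ 2}

/-- The weight `w` of the energy in the firewall functionals. -/
def wV (V : Euc n → ℝ) : ℝ := 1 / max 1 (-(4 * qHull V))

/-- The decay rate `κ₀`. -/
def kappa0 (lmin : ℝ) : ℝ := min (1 / 2) (lmin / 8)

/-- The "small curvature" radius `r_sc`. -/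
def rsc (d : ℕ) (lmin : ℝ) : ℝ := max (2 * ((d : ℝ) - 1)) (8 * ((d : ℝ) - 1) / lmin)

/-- The weight function `T_ρ ψ₀`. -/
def Tpsi (d : ℕ) (lmin : ℝ) (ρ r : ℝ) : ℝ :=
  if r ≤ rsc d lmin then Real.exp (-(kappa0 lmin) * |r - ρ|) * (r / rsc d lmin) ^ (d - 1)
  else Real.exp (-(kappa0 lmin) * |r - ρ|)

/-- The firewall functional `F₀` in the laboratory frame. -/
def F0 (V : Euc n → ℝ) (d : ℕ) (lmin : ℝ) (u : ℝ → ℝ → Euc n) (ρ t : ℝ) : ℝ :=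
  ∫ r in Ioi (0:ℝ),
    Tpsi d lmin ρ r * (wV V * (‖ur u r t‖ ^ 2 / 2 + V (u r t)) + ‖u r t‖ ^ 2 / 2)

/-- The set `Σ₀(t)` where the solution Escapes at distance `dEsc` from the origin. -/
def Sigma0 (u : ℝ → ℝ → Euc n) (dEsc t : ℝ) : Set ℝ := {r | 0 ≤ r ∧ dEsc < ‖u r t‖}

/-- The firewall differential inequality in the laboratory frame. -/
def FireIneq (V : Euc n → ℝ) (d : ℕ) (lmin dEsc : ℝ) (u : ℝ → ℝ → Euc n) (ν K : ℝ) : Prop :=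
  ∀ ρ ≥ rsc d lmin, ∀ t > (0:ℝ),
    DifferentiableAt ℝ (fun s => F0 V d lmin u ρ s) t ∧
    deriv (fun s => F0 V d lmin u ρ s) t ≤
      -ν * F0 V d lmin u ρ t + K * ∫ r in Sigma0 u dEsc t, Tpsi d lmin ρ r

/-- The quantity `δ = d_Esc √(min(w/2,1/4)/(κ₀+1))`. -/
def deltaEsc (dEsc w κ₀ : ℝ) : ℝ := dEsc * Real.sqrt (min (w / 2) (1 / 4) / (κ₀ + 1))

/-- The length `L₀`. -/
def L0c (κ₀ ν K δ : ℝ) : ℝ := κ₀⁻¹ * Real.log (16 * K / (ν * δ ^ 2 * κ₀))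

/-- The no-escape speed `c_noesc`. -/
def cNoEsc (κ₀ K L₀ δ : ℝ) : ℝ := 8 * K * L₀ / (κ₀ * δ ^ 2)

/-- The no-escape hull `h`. -/
def hull (δ L₀ : ℝ) (x : ℝ) : EReal :=
  if x < 0 then ⊤
  else if x ≤ L₀ then ((δ ^ 2 / 2 * (1 - x / (2 * L₀)) : ℝ) : EReal)
  else ((δ ^ 2 / 4 : ℝ) : EReal)

/-- The standing hypothesis that the firewall is below the two mirror hulls positioned
around `rHom t`. -/
def HullBound (V : Euc n → ℝ) (d : ℕ) (lmin : ℝ) (u : ℝ → ℝ → Euc n) (δ L₀ : ℝ)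
    (rHom : ℝ → ℝ) : Prop :=
  ∀ t ≥ (0:ℝ), rsc d lmin ≤ rHom t - 1 ∧
    ∀ r ≥ rsc d lmin, ((F0 V d lmin u r t : ℝ) : EReal) ≤
      max (hull δ L₀ (r - (rHom t - 1))) (hull δ L₀ (rHom t - r))

/-- The set whose infimum defines the escape point `r_esc(t)`. -/
def rescSet (V : Euc n → ℝ) (d : ℕ) (lmin : ℝ) (u : ℝ → ℝ → Euc n) (δ L₀ : ℝ)
    (rHom : ℝ → ℝ) (t : ℝ) : Set ℝ :=
  {rl | rl ∈ Icc (rsc d lmin) (rHom t) ∧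
    ∀ r ≥ rsc d lmin, ((F0 V d lmin u r t : ℝ) : EReal) ≤
      max (hull δ L₀ (r - rl)) (hull δ L₀ (rHom t - r))}

/-- The escape point `r_esc(t)`. -/
def rescF (V : Euc n → ℝ) (d : ℕ) (lmin : ℝ) (u : ℝ → ℝ → Euc n) (δ L₀ : ℝ)
    (rHom : ℝ → ℝ) (t : ℝ) : ℝ :=
  sInf (rescSet V d lmin u δ L₀ rHom t)

/-- `c̄`: upper limit of mean variations of a function over time intervals of length `s`. -/
def cbarF (f : ℝ → ℝ) : ℝ :=
  limsup (fun s => sSup {x : ℝ | ∃ t ≥ (0:ℝ), x = f (t + s) - f t} / s) atTop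

/-- `c̲`: lower limit of mean variations of a function over time intervals of length `s`. -/
def cunderF (f : ℝ → ℝ) : ℝ :=
  liminf (fun s => sInf {x : ℝ | ∃ t ≥ (0:ℝ), x = f (t + s) - f t} / s) atTop

/-- The decay rate `κ` in the travelling frame. -/
def kappaTF (lmin cno : ℝ) : ℝ := min (1 / 4) (lmin / (16 * (cno + 1)))

/-- The cut-off speed `c_cut` in the travelling frame. -/
def ccutTF (lmin lmax cno : ℝ) : ℝ := min (lmin / (8 * lmax)) (lmin / (8 * (cno + 1)))

/-- The energy weight `w'` in the travelling frame. -/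
def wTF (V : Euc n → ℝ) (cno : ℝ) : ℝ := min (wV V) (1 / (cno + 1) ^ 2)

/-- The weight function `χ` of the localized energy in the travelling frame. -/
def chiTF (d : ℕ) (lmin lmax cno c xcut r0 : ℝ) (ρ s : ℝ) : ℝ :=
  if ρ ≤ -r0 - c * s + rsc d lmin then
    Real.exp (c * ρ) * ((r0 + c * s + ρ) / rsc d lmin) ^ (d - 1)
  else if ρ ≤ xcut + ccutTF lmin lmax cno * s then Real.exp (c * ρ)
  else
    Real.exp ((c + kappaTF lmin cno) * (xcut + ccutTF lmin lmax cno * s) -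
      kappaTF lmin cno * ρ)

/-- The weight function `ψ` of the firewall in the travelling frame. -/
def psiTF (d : ℕ) (lmin lmax cno c xcut r0 : ℝ) (ρ s : ℝ) : ℝ :=
  if ρ ≤ -r0 - c * s + rsc d lmin then
    Real.exp ((c + kappaTF lmin cno) * ρ -
        kappaTF lmin cno * (xcut + ccutTF lmin lmax cno * s)) *
      ((r0 + c * s + ρ) / rsc d lmin) ^ (d - 1)
  else if ρ ≤ xcut + ccutTF lmin lmax cno * s then
    Real.exp ((c + kappaTF lmin cno) * ρ -
      kappaTF lmin cno * (xcut + ccutTF lmin lmax cno * s))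
  else
    Real.exp ((c + kappaTF lmin cno) * (xcut + ccutTF lmin lmax cno * s) -
      kappaTF lmin cno * ρ)

/-- The firewall functional `F(s)` in the travelling frame. -/
def FTF (V : Euc n → ℝ) (d : ℕ) (lmin lmax cno : ℝ) (u : ℝ → ℝ → Euc n)
    (t0 c xcut r0 : ℝ) (s : ℝ) : ℝ :=
  ∫ ρ in Ioi (-r0 - c * s),
    psiTF d lmin lmax cno c xcut r0 ρ s *
      (wTF V cno *
          (‖ur u (r0 + c * s + ρ) (t0 + s)‖ ^ 2 / 2 + V (u (r0 + c * s + ρ) (t0 + s))) +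
        ‖u (r0 + c * s + ρ) (t0 + s)‖ ^ 2 / 2)

/-- The set `Σ(s)` where the solution Escapes, in the travelling frame. -/
def SigmaTF (u : ℝ → ℝ → Euc n) (d : ℕ) (lmin dEsc : ℝ) (t0 c r0 : ℝ) (s : ℝ) : Set ℝ :=
  {ρ | -r0 - c * s + rsc d lmin ≤ ρ ∧ dEsc < ‖u (r0 + c * s + ρ) (t0 + s)‖}

/-- The weight function `ψ̃` in the standing frame. -/
def psiSF (d : ℕ) (κ cm cp : ℝ) (r t : ℝ) : ℝ :=
  if r ≤ cm * t then r ^ (d - 1) * Real.exp (-κ * (cm * t - r))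
  else if r ≤ cp * t then r ^ (d - 1)
  else r ^ (d - 1) * Real.exp (-κ * (r - cp * t))

/-- The firewall functional `F̃` in the standing frame. -/
def FSF (V : Euc n → ℝ) (d : ℕ) (κ cm cp : ℝ) (u : ℝ → ℝ → Euc n) (t : ℝ) : ℝ :=
  ∫ r in Ioi (0:ℝ),
    psiSF d κ cm cp r t * (wV V * (‖ur u r t‖ ^ 2 / 2 + V (u r t)) + ‖u r t‖ ^ 2 / 2)

/-- The quantity `δ_dissip(t)` measuring the dissipation around the escape point. -/
def deltaDissip (u : ℝ → ℝ → Euc n) (re : ℝ → ℝ) (cesc : ℝ) (t : ℝ) : ℝ :=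
  sInf {ε : ℝ | 0 < ε ∧
    (∫ τ in (-1:ℝ)..1, ∫ ρ in (-(1/ε))..(1/ε),
      ‖ut u (re (t + τ) + ρ) (t + τ) + cesc • ur u (re (t + τ) + ρ) (t + τ)‖ ^ 2) ≤ ε}

/-- `u` solves the radially symmetric system with initial datum `u₀`, in the sense of the
semi-flow on bounded continuous functions (classical for positive times). -/
def SolvesWithInit (d : ℕ) (V : Euc n → ℝ) (u : ℝ → ℝ → Euc n) (u₀ : ℝ → Euc n) : Prop :=
  (∀ r : ℝ, 0 ≤ r → u r 0 = u₀ r) ∧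
  (∀ t : ℝ, 0 ≤ t → ContinuousOn (fun r => u r t) (Ici 0) ∧ ∃ C, ∀ r : ℝ, 0 ≤ r → ‖u r t‖ ≤ C) ∧
  (∀ t : ℝ, 0 ≤ t → ∀ ε > (0:ℝ), ∃ δ > (0:ℝ), ∀ t' : ℝ, 0 ≤ t' → |t' - t| ≤ δ →
    ∀ r : ℝ, 0 ≤ r → ‖u r t' - u r t‖ ≤ ε) ∧
  (∀ t > (0:ℝ), ∀ r > (0:ℝ),
    DifferentiableAt ℝ (fun s => u s t) r ∧ DifferentiableAt ℝ (fun s => ur u s t) r) ∧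
  (∀ t > (0:ℝ), ∀ r : ℝ, 0 ≤ r → DifferentiableAt ℝ (fun s => u r s) t) ∧
  (∀ t > (0:ℝ), ∀ r > (0:ℝ),
    ut u r t = -gradient V (u r t) + (((d : ℝ) - 1) / r) • ur u r t + urr u r t) ∧
  (∀ t > (0:ℝ), DifferentiableAt ℝ (fun s => u s t) 0 ∧ ur u 0 t = 0)

/-! ### The weight function -/

theorem kappa0_pos {l : ℝ} (hl : 0 < l) : 0 < kappa0 l := by
  unfold kappa0
  positivity

theorem sub_one_pos_of_two_le {d : ℕ} (hd : 2 ≤ d) : (0 : ℝ) < d - 1 := by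
  have : (2 : ℝ) ≤ d := by exact_mod_cast hd
  linarith

theorem rsc_pos {d : ℕ} (hd : 2 ≤ d) (l : ℝ) : 0 < rsc d l := by
  have := sub_one_pos_of_two_le hd
  exact lt_max_of_lt_left (by linarith)

/-- The curvature term and the decay rate of the weight add up to a small quantity. -/
theorem kappa0_add_le {d : ℕ} (hd : 2 ≤ d) {l : ℝ} (hl : 0 < l) :
    ((d : ℝ) - 1) / rsc d l + kappa0 l ≤ min 1 (l / 4) := by
  have hp := sub_one_pos_of_two_le hd
  have hr := rsc_pos hd l
  have h1 : 2 * ((d : ℝ) - 1) ≤ rsc d l := le_max_left _ _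
  have h2 : 8 * ((d : ℝ) - 1) / l ≤ rsc d l := le_max_right _ _
  have h3 : ((d : ℝ) - 1) / rsc d l ≤ 1 / 2 := by
    rw [div_le_iff₀ hr]; linarith
  have h4 : ((d : ℝ) - 1) / rsc d l ≤ l / 8 := by
    rw [div_le_iff₀ hr]
    rw [div_le_iff₀ hl] at h2
    linarith
  have h5 : kappa0 l ≤ 1 / 2 := min_le_left _ _
  have h6 : kappa0 l ≤ l / 8 := min_le_right _ _
  exact le_min (by linarith) (by linarith)

theorem Tpsi_nonneg {d : ℕ} (hd : 2 ≤ d) (l ρ : ℝ) {r : ℝ} (hr : 0 ≤ r) :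
    0 ≤ Tpsi d l ρ r := by
  have := rsc_pos hd l
  unfold Tpsi
  split_ifs <;> positivity

theorem exp_neg_kappa0_abs_le {l : ℝ} (hl : 0 < l) (ρ r : ℝ) :
    Real.exp (-(kappa0 l) * |r - ρ|) ≤ Real.exp (-(kappa0 l) * (r - ρ)) := by
  have := kappa0_pos hl
  refine Real.exp_le_exp.2 ?_
  nlinarith [le_abs_self (r - ρ)]

theorem Tpsi_le_exp {d : ℕ} (hd : 2 ≤ d) {l : ℝ} (hl : 0 < l) (ρ : ℝ) {r : ℝ} (hr : 0 ≤ r) :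
    Tpsi d l ρ r ≤ Real.exp (-(kappa0 l) * (r - ρ)) := by
  refine le_trans ?_ (exp_neg_kappa0_abs_le hl ρ r)
  have := rsc_pos hd l
  unfold Tpsi
  split_ifs with h
  · exact mul_le_of_le_one_right (Real.exp_pos _).le
      (pow_le_one₀ (by positivity) ((div_le_one this).2 h))
  · exact le_rfl

theorem Tpsi_zero {d : ℕ} (hd : 2 ≤ d) (l ρ : ℝ) : Tpsi d l ρ 0 = 0 := by
  have h : d - 1 ≠ 0 := by omega
  simp [Tpsi, (rsc_pos hd l).le, h]

theorem continuous_Tpsi {d : ℕ} (hd : 2 ≤ d) (l ρ : ℝ) : Continuous (Tpsi d l ρ) := by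
  have := (rsc_pos hd l).ne'
  unfold Tpsi
  refine Continuous.if_le (by fun_prop) (by fun_prop) continuous_id continuous_const ?_
  rintro r (rfl : r = _)
  simp [div_self this]

/-- Away from its two kinks the weight is differentiable, and its derivative is close to the
derivative which would compensate exactly the curvature term. -/
theorem exists_hasDerivAt_Tpsi {d : ℕ} (hd : 2 ≤ d) {l : ℝ} (hl : 0 < l) {ρ : ℝ}
    (hρ : rsc d l ≤ ρ) {r : ℝ} (hr : 0 < r) (h1 : r ≠ rsc d l) (h2 : r ≠ ρ) :
    ∃ ψ' : ℝ, HasDerivAt (Tpsi d l ρ) ψ' r ∧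
      |((d : ℝ) - 1) / r * Tpsi d l ρ r - ψ'| ≤ min 1 (l / 4) * Tpsi d l ρ r := by
  have hp := sub_one_pos_of_two_le hd
  have hs := rsc_pos hd l
  have hκ := kappa0_pos hl
  have hsum := kappa0_add_le hd hl
  have hcurv : 0 < ((d : ℝ) - 1) / rsc d l := div_pos hp hs
  have hψ := Tpsi_nonneg hd l ρ hr.le
  have hexp : HasDerivAt (fun r => Real.exp (-(kappa0 l) * |r - ρ|))
      (Real.exp (-(kappa0 l) * |r - ρ|) * (-(kappa0 l) * (SignType.sign (r - ρ) : ℝ))) r := by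
    have h := (hasDerivAt_abs (sub_ne_zero.2 h2)).comp r ((hasDerivAt_id r).sub_const ρ)
    simpa using (h.const_mul (-(kappa0 l))).exp
  rcases lt_or_gt_of_ne h1 with h | h
  · have hev : Tpsi d l ρ =ᶠ[𝓝 r] fun r =>
        Real.exp (-(kappa0 l) * |r - ρ|) * (r / rsc d l) ^ (d - 1) := by
      filter_upwards [Iio_mem_nhds h] with x hx
      simp [Tpsi, (le_of_lt hx : x ≤ rsc d l)]
    have hsign : (SignType.sign (r - ρ) : ℝ) = -1 := by
      rw [sign_neg (by linarith)]; simp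
    have hpow := ((hasDerivAt_id r).div_const (rsc d l)).pow (d - 1)
    have hder := (hexp.mul hpow).congr_of_eventuallyEq hev
    refine ⟨_, hder, ?_⟩
    have hval := hev.eq_of_nhds
    obtain ⟨p, rfl⟩ : ∃ p, d = p + 2 := ⟨d - 2, by omega⟩
    have key : (((p + 2 : ℕ) : ℝ) - 1) / r * Tpsi (p + 2) l ρ r -
        (Real.exp (-(kappa0 l) * |r - ρ|) * (-(kappa0 l) * (SignType.sign (r - ρ) : ℝ)) *
            (r / rsc (p + 2) l) ^ (p + 2 - 1) +
          Real.exp (-(kappa0 l) * |r - ρ|) *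
            (((p + 2 - 1 : ℕ) : ℝ) * (r / rsc (p + 2) l) ^ (p + 2 - 1 - 1) *
              (1 / rsc (p + 2) l))) = -(kappa0 l * Tpsi (p + 2) l ρ r) := by
      rw [hval, hsign]
      simp only [Nat.add_sub_cancel, show p + 2 - 1 = p + 1 by omega]
      have hq := hs.ne'
      generalize rsc (p + 2) l = q at hq ⊢
      rw [pow_succ]
      generalize (r / q) ^ p = z
      push_cast
      field_simp
      ring
    have key' := congrArg abs key
    rw [abs_neg, abs_of_nonneg (mul_nonneg hκ.le hψ)] at key'
    refine le_trans (le_of_eq ?_) (mul_le_mul_of_nonneg_right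
      (show kappa0 l ≤ min 1 (l / 4) by linarith) hψ)
    exact key'
  · have hev : Tpsi d l ρ =ᶠ[𝓝 r] fun r => Real.exp (-(kappa0 l) * |r - ρ|) := by
      filter_upwards [Ioi_mem_nhds h] with x hx
      simp [Tpsi, not_le.2 (show rsc d l < x from hx)]
    have hder := hexp.congr_of_eventuallyEq hev
    refine ⟨_, hder, ?_⟩
    rw [hev.eq_of_nhds]
    have hsign : |(SignType.sign (r - ρ) : ℝ)| ≤ 1 := by
      rcases SignType.trichotomy (SignType.sign (r - ρ)) with h | h | h <;> simp [h]
    have hle : ((d : ℝ) - 1) / r ≤ ((d : ℝ) - 1) / rsc d l :=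
      div_le_div_of_nonneg_left hp.le hs h.le
    have hnn : 0 ≤ ((d : ℝ) - 1) / r := by positivity
    set e := Real.exp (-(kappa0 l) * |r - ρ|)
    have he : 0 < e := Real.exp_pos _
    rw [show ((d : ℝ) - 1) / r * e - e * (-kappa0 l * (SignType.sign (r - ρ) : ℝ)) =
      (((d : ℝ) - 1) / r + kappa0 l * (SignType.sign (r - ρ) : ℝ)) * e by ring, abs_mul,
      abs_of_pos he]
    refine mul_le_mul_of_nonneg_right ?_ he.le
    refine (abs_add_le _ _).trans ?_
    rw [abs_mul, abs_of_nonneg hnn, abs_of_pos hκ]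
    nlinarith

/-- Exponential bound for the derivative of the weight. -/
theorem abs_deriv_Tpsi_le {d : ℕ} (hd : 2 ≤ d) {l : ℝ} (hl : 0 < l) {ρ : ℝ}
    (hρ : rsc d l ≤ ρ) {r : ℝ} (hr : 0 < r) (h1 : r ≠ rsc d l) (h2 : r ≠ ρ) :
    |deriv (Tpsi d l ρ) r| ≤
      (((d : ℝ) - 1) / rsc d l + 1) * Real.exp (-(kappa0 l) * (r - ρ)) := by
  obtain ⟨ψ', hψ', hle⟩ := exists_hasDerivAt_Tpsi hd hl hρ hr h1 h2
  rw [hψ'.deriv]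
  have hp := sub_one_pos_of_two_le hd
  have hs := rsc_pos hd l
  have hψ := Tpsi_nonneg hd l ρ hr.le
  have hψE := Tpsi_le_exp hd hl ρ hr.le
  have hmin : min 1 (l / 4) ≤ 1 := min_le_left _ _
  have hcurv : ((d : ℝ) - 1) / r * Tpsi d l ρ r ≤
      ((d : ℝ) - 1) / rsc d l * Real.exp (-(kappa0 l) * (r - ρ)) := by
    rcases le_or_gt r (rsc d l) with h | h
    · have h3 : Tpsi d l ρ r ≤ Real.exp (-(kappa0 l) * (r - ρ)) * (r / rsc d l) := by
        rw [Tpsi, if_pos h]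
        refine mul_le_mul (exp_neg_kappa0_abs_le hl ρ r) ?_ (by positivity) (by positivity)
        exact pow_le_of_le_one (by positivity) ((div_le_one hs).2 h) (by omega)
      calc ((d : ℝ) - 1) / r * Tpsi d l ρ r
          ≤ ((d : ℝ) - 1) / r * (Real.exp (-(kappa0 l) * (r - ρ)) * (r / rsc d l)) := by gcongr
        _ = _ := by field_simp
    · gcongr
  have hnn : 0 ≤ ((d : ℝ) - 1) / r * Tpsi d l ρ r := by positivity
  have h4 := abs_le.1 hle
  have h5 : min 1 (l / 4) * Tpsi d l ρ r ≤ Tpsi d l ρ r := by nlinarith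
  rw [abs_le]
  constructor <;> nlinarith

/-! ### Integration on the half-line -/

theorem integrableOn_const_mul_exp {κ : ℝ} (hκ : 0 < κ) (ρ C : ℝ) :
    IntegrableOn (fun r => C * Real.exp (-κ * (r - ρ))) (Ioi 0) := by
  have h := (exp_neg_integrableOn_Ioi 0 hκ).const_mul (C * Real.exp (κ * ρ))
  refine h.congr (Eventually.of_forall fun r => ?_)
  simp only [mul_assoc, ← Real.exp_add]
  ring_nf

theorem integral_Ioi_deriv_eq_zero {f f' : ℝ → ℝ} {s : Set ℝ} (hs : s.Countable)
    (hf : Continuous f) (h0 : f 0 = 0) (hlim : Tendsto f atTop (𝓝 0))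
    (hderiv : ∀ r > 0, r ∉ s → HasDerivAt f (f' r) r) (hInt : IntegrableOn f' (Ioi 0)) :
    ∫ r in Ioi 0, f' r = 0 := by
  have h1 := intervalIntegral_tendsto_integral_Ioi 0 hInt tendsto_id
  refine tendsto_nhds_unique h1 (hlim.congr' ?_)
  filter_upwards [eventually_ge_atTop 0] with b hb
  rw [id, integral_eq_of_hasDerivAt_off_countable_of_le f f' hb hs hf.continuousOn
    (fun x hx => hderiv x hx.1.1 hx.2), h0, sub_zero]
  exact (intervalIntegrable_iff_integrableOn_Ioc_of_le hb).2 (hInt.mono_set Ioc_subset_Ioi_self)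

theorem ae_restrict_Ioi_avoid (a b : ℝ) :
    ∀ᵐ r ∂volume.restrict (Ioi (0 : ℝ)), 0 < r ∧ r ≠ a ∧ r ≠ b := by
  have h1 : ∀ᵐ r ∂volume.restrict (Ioi (0 : ℝ)), 0 < r := ae_restrict_mem measurableSet_Ioi
  have h2 (c : ℝ) : ∀ᵐ r ∂volume.restrict (Ioi (0 : ℝ)), r ≠ c :=
    ae_restrict_of_ae (Measure.ae_ne volume c)
  filter_upwards [h1, h2 a, h2 b] with r ha hb hc using ⟨ha, hb, hc⟩

theorem abs_deriv_Tpsi_mul_add_le {d : ℕ} (hd : 2 ≤ d) {l : ℝ} (hl : 0 < l) {ρ : ℝ}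
    (hρ : rsc d l ≤ ρ) {r : ℝ} (hr : 0 < r) (h1 : r ≠ rsc d l) (h2 : r ≠ ρ) {a b B : ℝ}
    (ha : |a| ≤ B) (hb : |b| ≤ B) :
    |deriv (Tpsi d l ρ) r * a + Tpsi d l ρ r * b| ≤
      ((((d : ℝ) - 1) / rsc d l + 1) * B + B) * Real.exp (-(kappa0 l) * (r - ρ)) := by
  have h1 := abs_deriv_Tpsi_le hd hl hρ hr h1 h2
  have h2 := Tpsi_le_exp hd hl ρ hr.le
  have h3 := Tpsi_nonneg hd l ρ hr.le
  have h4 := mul_le_mul h1 ha (abs_nonneg _) ((abs_nonneg _).trans h1)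
  have h5 := mul_le_mul h2 hb (abs_nonneg _) (h3.trans h2)
  refine (abs_add_le _ _).trans ?_
  rw [abs_mul, abs_mul, abs_of_nonneg h3]
  linarith

/-- Integrability of bounded functions against the weight and its derivative. -/
theorem integrableOn_deriv_Tpsi_mul_add {d : ℕ} (hd : 2 ≤ d) {l : ℝ} (hl : 0 < l) {ρ : ℝ}
    (hρ : rsc d l ≤ ρ) {f g : ℝ → ℝ} {B : ℝ}
    (hf : AEStronglyMeasurable f (volume.restrict (Ioi 0)))
    (hg : AEStronglyMeasurable g (volume.restrict (Ioi 0)))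
    (hfB : ∀ r > 0, |f r| ≤ B) (hgB : ∀ r > 0, |g r| ≤ B) :
    IntegrableOn (fun r => deriv (Tpsi d l ρ) r * f r + Tpsi d l ρ r * g r) (Ioi 0) := by
  refine Integrable.mono' (integrableOn_const_mul_exp (kappa0_pos hl) ρ
    ((((d : ℝ) - 1) / rsc d l + 1) * B + B))
    (((measurable_deriv _).aestronglyMeasurable.mul hf).add
      ((continuous_Tpsi hd l ρ).aestronglyMeasurable.mul hg)) ?_
  filter_upwards [ae_restrict_Ioi_avoid (rsc d l) ρ] with r hr
  exact abs_deriv_Tpsi_mul_add_le hd hl hρ hr.1 hr.2.1 hr.2.2 (hfB r hr.1) (hgB r hr.1)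

theorem integrableOn_Tpsi_mul {d : ℕ} (hd : 2 ≤ d) {l : ℝ} (hl : 0 < l) {ρ : ℝ}
    (hρ : rsc d l ≤ ρ) {g : ℝ → ℝ} {B : ℝ}
    (hg : AEStronglyMeasurable g (volume.restrict (Ioi 0))) (hgB : ∀ r > 0, |g r| ≤ B) :
    IntegrableOn (fun r => Tpsi d l ρ r * g r) (Ioi 0) := by
  have h := integrableOn_deriv_Tpsi_mul_add hd hl hρ (f := fun _ => 0)
    aestronglyMeasurable_const hg
    (fun r hr => by simpa using (abs_nonneg _).trans (hgB r hr)) hgB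
  simpa using h

theorem tendsto_Tpsi_mul_atTop {d : ℕ} (hd : 2 ≤ d) {l : ℝ} (hl : 0 < l) (ρ : ℝ)
    {g : ℝ → ℝ} {B : ℝ} (hgB : ∀ r > 0, |g r| ≤ B) :
    Tendsto (fun r => Tpsi d l ρ r * g r) atTop (𝓝 0) := by
  have hlim : Tendsto (fun r => Real.exp (-(kappa0 l) * (r - ρ)) * B) atTop (𝓝 0) := by
    rw [← zero_mul B]
    refine Tendsto.mul_const B (Real.tendsto_exp_atBot.comp ?_)
    exact (tendsto_atTop_add_const_right _ _ tendsto_id).const_mul_atTop_of_neg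
      (neg_neg_of_pos (kappa0_pos hl))
  refine squeeze_zero_norm' ?_ hlim
  filter_upwards [eventually_gt_atTop 0] with r hr
  have h2 := Tpsi_le_exp hd hl ρ hr.le
  have h3 := Tpsi_nonneg hd l ρ hr.le
  rw [Real.norm_eq_abs, abs_mul, abs_of_nonneg h3]
  exact mul_le_mul h2 (hgB r hr) (abs_nonneg _) (h3.trans h2)

/-- Integration by parts against the weight: there are no boundary terms. -/
theorem integral_deriv_Tpsi_mul_add {d : ℕ} (hd : 2 ≤ d) {l : ℝ} (hl : 0 < l) {ρ : ℝ}
    (hρ : rsc d l ≤ ρ) {f f' : ℝ → ℝ} {B : ℝ} (hf : ∀ r, HasDerivAt f (f' r) r)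
    (hfB : ∀ r > 0, |f r| ≤ B) (hfB' : ∀ r > 0, |f' r| ≤ B) :
    ∫ r in Ioi 0, (deriv (Tpsi d l ρ) r * f r + Tpsi d l ρ r * f' r) = 0 := by
  have hcont : Continuous f := continuous_iff_continuousAt.2 fun r => (hf r).continuousAt
  have hmeas : Measurable f' := by
    rw [← funext fun r => (hf r).deriv]
    exact measurable_deriv f
  refine integral_Ioi_deriv_eq_zero (f := fun r => Tpsi d l ρ r * f r)
    (s := {rsc d l, ρ}) (Set.toFinite _).countable
    ((continuous_Tpsi hd l ρ).mul hcont) (by simp [Tpsi_zero hd])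
    (tendsto_Tpsi_mul_atTop hd hl ρ hfB) ?_
    (integrableOn_deriv_Tpsi_mul_add hd hl hρ hcont.aestronglyMeasurable
      hmeas.aestronglyMeasurable hfB hfB')
  intro r hr hrs
  simp only [mem_insert_iff, mem_singleton_iff, not_or] at hrs
  obtain ⟨ψ', hψ', -⟩ := exists_hasDerivAt_Tpsi hd hl hρ hr hrs.1 hrs.2
  exact hψ'.differentiableAt.hasDerivAt.mul (hf r)

/-! ### The potential close to the origin -/

theorem hasDerivAt_comp_gradient {V : Euc n → ℝ} (hV : Differentiable ℝ V)
    {γ : ℝ → Euc n} {γ' : Euc n} {s : ℝ} (hγ : HasDerivAt γ γ' s) :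
    HasDerivAt (fun s => V (γ s)) ⟪gradient V (γ s), γ'⟫ s :=
  (hV (γ s)).hasGradientAt.hasFDerivAt.comp_hasDerivAt s hγ

theorem contDiff_gradient {V : Euc n → ℝ} (hV : ContDiff ℝ 2 V) : ContDiff ℝ 1 (gradient V) :=
  (InnerProductSpace.toDual ℝ (Euc n)).symm.contDiff.comp (hV.fderiv_right (by norm_num))

/-- Convexity estimates in a ball around the origin. -/
theorem convexity_estimates {V : Euc n → ℝ} (hV : ContDiff ℝ 2 V) (D : EscData n V)
    (h0 : (0 : Euc n) ∈ MinSet V) (hV0 : V 0 = 0) {x : Euc n} (hx : ‖x‖ ≤ D.dEsc) :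
    D.lmin / 2 * ‖x‖ ^ 2 ≤ ⟪x, gradient V x⟫ ∧ V x ≤ ⟪x, gradient V x⟫ := by
  have hVd : Differentiable ℝ V := hV.differentiable (by norm_num)
  have hline (s : ℝ) : HasDerivAt (fun s : ℝ => s • x) x s := by
    simpa using (hasDerivAt_id s).smul_const x
  have hφ (s : ℝ) : HasDerivAt (fun s : ℝ => ⟪x, gradient V (s • x)⟫)
      ⟪x, hess V (s • x) x⟫ s := by
    have hg : HasFDerivAt (gradient V) (hess V (s • x)) (s • x) :=
      ((contDiff_gradient hV).differentiable (by norm_num) _).hasFDerivAt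
    simpa using (hasDerivAt_const s x).inner ℝ (hg.comp_hasDerivAt s (hline s))
  have hin {s : ℝ} (hs : s ∈ Icc (0 : ℝ) 1) :
      D.lmin / 2 * ‖x‖ ^ 2 ≤ ⟪x, hess V (s • x) x⟫ := by
    refine D.esc_lower 0 h0 _ ?_ x
    rw [sub_zero, norm_smul, Real.norm_eq_abs, abs_of_nonneg hs.1]
    nlinarith [norm_nonneg x, hs.2]
  have hlin : MonotoneOn (fun s : ℝ => ⟪x, gradient V (s • x)⟫ - s * (D.lmin / 2 * ‖x‖ ^ 2))
      (Icc 0 1) := by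
    have hd (s : ℝ) := (hφ s).sub ((hasDerivAt_id s).mul_const (D.lmin / 2 * ‖x‖ ^ 2))
    refine monotoneOn_of_hasDerivWithinAt_nonneg (convex_Icc 0 1)
      (fun s _ => (hd s).continuousAt.continuousWithinAt) (fun s _ => (hd s).hasDerivWithinAt) ?_
    intro s hs
    rw [interior_Icc] at hs
    have := hin (Ioo_subset_Icc_self hs)
    simpa using this
  have hmem0 : (0 : ℝ) ∈ Icc (0 : ℝ) 1 := by simp
  have hmem1 : (1 : ℝ) ∈ Icc (0 : ℝ) 1 := by simp
  have hl := D.lmin_pos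
  refine ⟨?_, ?_⟩
  · have h := hlin hmem0 hmem1 zero_le_one
    simp only [zero_smul, h0.1, inner_zero_right, one_smul] at h
    linarith
  · have hmono : MonotoneOn (fun s : ℝ => s * ⟪x, gradient V x⟫ - V (s • x)) (Icc 0 1) := by
      have hd (s : ℝ) := ((hasDerivAt_id s).mul_const ⟪x, gradient V x⟫).sub
        (hasDerivAt_comp_gradient hVd (hline s))
      refine monotoneOn_of_hasDerivWithinAt_nonneg (convex_Icc 0 1)
        (fun s _ => (hd s).continuousAt.continuousWithinAt)
        (fun s _ => (hd s).hasDerivWithinAt) ?_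
      intro s hs
      rw [interior_Icc] at hs
      have h := hlin (Ioo_subset_Icc_self hs) hmem1 hs.2.le
      simp only [one_smul] at h
      rw [real_inner_comm x (gradient V (s • x))]
      have hnn : 0 ≤ D.lmin / 2 * ‖x‖ ^ 2 := by positivity
      nlinarith [hs.2]
    have h := hmono hmem0 hmem1 zero_le_one
    simp only [zero_smul, hV0, one_smul] at h
    linarith

/-! ### Regularity of radial solutions -/

theorem abs_inner_le_mul {a b : Euc n} {A B : ℝ} (ha : ‖a‖ ≤ A) (hb : ‖b‖ ≤ B) :
    |⟪a, b⟫| ≤ A * B :=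
  (abs_real_inner_le_norm a b).trans
    (mul_le_mul ha hb (norm_nonneg _) ((norm_nonneg _).trans ha))

namespace IsRadialSolution

variable {d : ℕ} {V : Euc n → ℝ} {u : ℝ → ℝ → Euc n}

theorem hasDerivAt_space (hu : IsRadialSolution d V u) {t : ℝ} (ht : 0 < t) (r : ℝ) :
    HasDerivAt (fun s => u s t) (ur u r t) r :=
  (hu.diff_r t ht r).hasDerivAt

theorem hasDerivAt_ur (hu : IsRadialSolution d V u) {t : ℝ} (ht : 0 < t) (r : ℝ) :
    HasDerivAt (fun s => ur u s t) (urr u r t) r :=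
  (hu.diff_rr t ht r).hasDerivAt

theorem hasDerivAt_time (hu : IsRadialSolution d V u) {t : ℝ} (ht : 0 < t) (r : ℝ) :
    HasDerivAt (fun s => u r s) (ut u r t) t :=
  (hu.diff_t t ht r).hasDerivAt

theorem continuous_space (hu : IsRadialSolution d V u) {t : ℝ} (ht : 0 < t) :
    Continuous fun r => u r t :=
  continuous_iff_continuousAt.2 fun r => (hu.hasDerivAt_space ht r).continuousAt

theorem continuous_ur (hu : IsRadialSolution d V u) {t : ℝ} (ht : 0 < t) :
    Continuous fun r => ur u r t :=
  continuous_iff_continuousAt.2 fun r => (hu.hasDerivAt_ur ht r).continuousAt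

theorem exists_bound (hu : IsRadialSolution d V u) :
    ∃ C : ℝ, 0 ≤ C ∧ ∀ r t : ℝ, 0 ≤ r → 0 < t →
      ‖u r t‖ ≤ C ∧ ‖ur u r t‖ ≤ C ∧ ‖urr u r t‖ ≤ C ∧ ‖ut u r t‖ ≤ C := by
  obtain ⟨C, hC⟩ := hu.bounded
  have key (r t : ℝ) (hr : 0 ≤ r) (ht : 0 < t) :
      ‖u r t‖ ≤ C ∧ ‖ur u r t‖ ≤ C ∧ ‖urr u r t‖ ≤ C ∧ ‖ut u r t‖ ≤ C := by
    have h := hC r t hr ht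
    have h1 := norm_nonneg (u r t)
    have h2 := norm_nonneg (ur u r t)
    have h3 := norm_nonneg (urr u r t)
    have h4 := norm_nonneg (ut u r t)
    exact ⟨by linarith, by linarith, by linarith, by linarith⟩
  exact ⟨C, (norm_nonneg _).trans (key 0 1 le_rfl one_pos).1, key⟩

theorem continuousOn_ut (hu : IsRadialSolution d V u) (hV : ContDiff ℝ 2 V) {t : ℝ}
    (ht : 0 < t) : ContinuousOn (fun r => ut u r t) (Ioi 0) := by
  have hg := (contDiff_gradient hV).continuous
  have h1 := hu.continuous_space ht
  have h2 := hu.continuous_ur ht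
  have h3 := hu.cont_rr t ht
  refine ContinuousOn.congr (f := fun r => -gradient V (u r t) + (((d : ℝ) - 1) / r) • ur u r t +
    urr u r t) ?_ fun r hr => hu.pde r hr t ht
  have hinv : ContinuousOn (fun r : ℝ => ((d : ℝ) - 1) / r) (Ioi 0) :=
    continuousOn_const.div continuousOn_id fun r hr => (ne_of_gt hr)
  exact ((hg.comp h1).neg.continuousOn.add (hinv.smul h2.continuousOn)).add h3.continuousOn

theorem aestronglyMeasurable_ut (hu : IsRadialSolution d V u) (hV : ContDiff ℝ 2 V) {t : ℝ}
    (ht : 0 < t) : AEStronglyMeasurable (fun r => ut u r t) (volume.restrict (Ioi 0)) :=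
  (hu.continuousOn_ut hV ht).aestronglyMeasurable measurableSet_Ioi

/-- Difference quotients in space approximate `u_r` uniformly in time. -/
theorem norm_slope_sub_ur_le (hu : IsRadialSolution d V u) {C : ℝ}
    (hC : ∀ r t : ℝ, 0 ≤ r → 0 < t → ‖urr u r t‖ ≤ C) {r t h : ℝ} (hr : 0 ≤ r) (ht : 0 < t)
    (hh : 0 < h) : ‖h⁻¹ • (u (r + h) t - u r t) - ur u r t‖ ≤ C * h := by
  have hC0 : 0 ≤ C := (norm_nonneg _).trans (hC r t hr ht)
  have hmem : r ∈ Icc r (r + h) := ⟨le_rfl, by linarith⟩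
  have hmem' : r + h ∈ Icc r (r + h) := ⟨by linarith, le_rfl⟩
  have hlip (x : ℝ) (hx : x ∈ Icc r (r + h)) : ‖ur u x t - ur u r t‖ ≤ C * h := by
    have h1 := (convex_Icc r (r + h)).norm_image_sub_le_of_norm_hasDerivWithin_le
      (fun y _ => (hu.hasDerivAt_ur ht y).hasDerivWithinAt)
      (fun y hy => hC y t (hr.trans hy.1) ht) hmem hx
    refine h1.trans (mul_le_mul_of_nonneg_left ?_ hC0)
    rw [Real.norm_eq_abs, abs_of_nonneg (by linarith [hx.1])]
    linarith [hx.2]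
  have hd (x : ℝ) : HasDerivAt (fun x => u x t - x • ur u r t) (ur u x t - ur u r t) x := by
    have h := (hu.hasDerivAt_space ht x).sub ((hasDerivAt_id x).smul_const (ur u r t))
    rwa [one_smul] at h
  have h2 := (convex_Icc r (r + h)).norm_image_sub_le_of_norm_hasDerivWithin_le
    (fun y _ => (hd y).hasDerivWithinAt) hlip hmem hmem'
  rw [add_sub_cancel_left, Real.norm_eq_abs, abs_of_pos hh] at h2
  have h3 : h⁻¹ • (u (r + h) t - u r t) - ur u r t =
      h⁻¹ • ((u (r + h) t - (r + h) • ur u r t) - (u r t - r • ur u r t)) := by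
    rw [show (u (r + h) t - (r + h) • ur u r t) - (u r t - r • ur u r t) =
      (u (r + h) t - u r t) - h • ur u r t by module, smul_sub (h⁻¹) _ (h • ur u r t), smul_smul,
      inv_mul_cancel₀ hh.ne', one_smul]
  rw [h3, norm_smul, norm_inv, Real.norm_eq_abs, abs_of_pos hh, inv_mul_le_iff₀ hh]
  linarith

theorem continuousAt_ur_time (hu : IsRadialSolution d V u) {r t : ℝ} (hr : 0 ≤ r) (ht : 0 < t) :
    ContinuousAt (fun s => ur u r s) t := by
  obtain ⟨C, hC0, hC⟩ := hu.exists_bound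
  refine continuousAt_of_locally_uniform_approx_of_continuousAt fun U hU => ?_
  obtain ⟨ε, hε, hεU⟩ := Metric.mem_uniformity_dist.1 hU
  have hh : 0 < ε / (2 * (C + 1)) := by positivity
  refine ⟨Ioi 0, Ioi_mem_nhds ht,
    fun s => (ε / (2 * (C + 1)))⁻¹ • (u (r + ε / (2 * (C + 1))) s - u r s), ?_, ?_⟩
  · exact ((hu.hasDerivAt_time ht _).continuousAt.sub
      (hu.hasDerivAt_time ht _).continuousAt).const_smul (ε / (2 * (C + 1)))⁻¹
  · intro s hs
    refine hεU ?_
    rw [dist_comm, dist_eq_norm]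
    refine (hu.norm_slope_sub_ur_le (fun r t hr ht => (hC r t hr ht).2.2.1) hr hs hh).trans_lt ?_
    rw [← mul_div_assoc, div_lt_iff₀ (by positivity)]
    nlinarith

theorem continuousAt_urr_time (hu : IsRadialSolution d V u) (hV : ContDiff ℝ 2 V) {r t : ℝ}
    (hr : 0 < r) (ht : 0 < t) : ContinuousAt (fun s => urr u r s) t := by
  have hg := (contDiff_gradient hV).continuous
  have h1 : ContinuousAt (fun s => ut u r s) t := (hu.cont_t r).continuousAt (Ioi_mem_nhds ht)
  have h2 : ContinuousAt (fun s => gradient V (u r s)) t :=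
    hg.continuousAt.comp (hu.hasDerivAt_time ht r).continuousAt
  have h3 := (hu.continuousAt_ur_time hr.le ht).const_smul (((d : ℝ) - 1) / r)
  refine ((h1.add h2).sub h3).congr ?_
  filter_upwards [Ioi_mem_nhds ht] with s hs
  simp only [Pi.add_apply, Pi.sub_apply, hu.pde r hr s hs, Pi.smul_apply]
  abel

theorem norm_slope_time_le (hu : IsRadialSolution d V u) {C : ℝ}
    (hC : ∀ r t : ℝ, 0 ≤ r → 0 < t → ‖ut u r t‖ ≤ C) {r s t : ℝ} (hr : 0 ≤ r) (hs : 0 < s)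
    (ht : 0 < t) (hst : s ≠ t) : ‖slope (fun s => u r s) t s‖ ≤ C := by
  have h := (convex_Ioi (0 : ℝ)).norm_image_sub_le_of_norm_hasDerivWithin_le
    (fun y hy => (hu.hasDerivAt_time hy r).hasDerivWithinAt)
    (fun y hy => hC r y hr hy) ht hs
  rw [slope_def_module, norm_smul, norm_inv,
    inv_mul_le_iff₀ (norm_pos_iff.2 (sub_ne_zero.2 hst))]
  linarith

/-! ### Time derivative of the firewall -/

theorem integrableOn_kinetic (hu : IsRadialSolution d V u) (hd : 2 ≤ d) {l : ℝ} (hl : 0 < l)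
    {ρ : ℝ} (hρ : rsc d l ≤ ρ) {t : ℝ} (ht : 0 < t) :
    IntegrableOn (fun r => Tpsi d l ρ r * (‖ur u r t‖ ^ 2 / 2)) (Ioi 0) := by
  obtain ⟨C, hC0, hC⟩ := hu.exists_bound
  refine integrableOn_Tpsi_mul hd hl hρ (B := C ^ 2 / 2)
    (((hu.continuous_ur ht).norm.pow 2).div_const 2).aestronglyMeasurable fun r hr => ?_
  have := (hC r t hr.le ht).2.1
  rw [abs_of_nonneg (by positivity)]
  gcongr

/-- Time derivative of the weighted kinetic part, although `u_r` need not be differentiable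
with respect to time. -/
theorem hasDerivAt_integral_kinetic (hu : IsRadialSolution d V u) (hV : ContDiff ℝ 2 V)
    (hd : 2 ≤ d) {l : ℝ} (hl : 0 < l) {ρ : ℝ} (hρ : rsc d l ≤ ρ) {t : ℝ} (ht : 0 < t) :
    HasDerivAt (fun s => ∫ r in Ioi 0, Tpsi d l ρ r * (‖ur u r s‖ ^ 2 / 2))
      (∫ r in Ioi 0, -(deriv (Tpsi d l ρ) r * ⟪ut u r t, ur u r t⟫ +
        Tpsi d l ρ r * ⟪ut u r t, urr u r t⟫)) t := by
  obtain ⟨C, hC0, hC⟩ := hu.exists_bound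
  have hhalf {a b : Euc n} (ha : ‖a‖ ≤ C) (hb : ‖b‖ ≤ C) : ‖(1 / 2 : ℝ) • (a + b)‖ ≤ C := by
    rw [norm_smul, Real.norm_eq_abs, abs_of_pos (by norm_num)]
    linarith [norm_add_le a b]
  have hkin {s : ℝ} (hs : 0 < s) := hu.integrableOn_kinetic hd hl hρ hs
  rw [hasDerivAt_iff_tendsto_slope]
  have hpos : ∀ᶠ s in 𝓝[≠] t, 0 < s ∧ s ≠ t :=
    Filter.Eventually.and (mem_nhdsWithin_of_mem_nhds (Ioi_mem_nhds ht)) self_mem_nhdsWithin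
  have hslope : ∀ᶠ s in 𝓝[≠] t,
      (∫ r in Ioi 0, -(deriv (Tpsi d l ρ) r *
          ⟪slope (fun s => u r s) t s, (1 / 2 : ℝ) • (ur u r s + ur u r t)⟫ +
        Tpsi d l ρ r *
          ⟪slope (fun s => u r s) t s, (1 / 2 : ℝ) • (urr u r s + urr u r t)⟫)) =
      slope (fun s => ∫ r in Ioi 0, Tpsi d l ρ r * (‖ur u r s‖ ^ 2 / 2)) t s := by
    filter_upwards [hpos] with s ⟨hs, hst⟩
    set f : ℝ → ℝ := fun r => ⟪u r s - u r t, (1 / 2 : ℝ) • (ur u r s + ur u r t)⟫ with hf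
    set f' : ℝ → ℝ := fun r =>
      ⟪u r s - u r t, (1 / 2 : ℝ) • (urr u r s + urr u r t)⟫ +
        ⟪ur u r s - ur u r t, (1 / 2 : ℝ) • (ur u r s + ur u r t)⟫ with hf'
    have hder (r : ℝ) : HasDerivAt f (f' r) r :=
      ((hu.hasDerivAt_space hs r).sub (hu.hasDerivAt_space ht r)).inner ℝ
        (((hu.hasDerivAt_ur hs r).add (hu.hasDerivAt_ur ht r)).const_smul (1 / 2 : ℝ))
    have hsub {a b : Euc n} (ha : ‖a‖ ≤ C) (hb : ‖b‖ ≤ C) : ‖a - b‖ ≤ 2 * C := by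
      linarith [norm_sub_le a b]
    have hfB (r : ℝ) (hr : 0 < r) : |f r| ≤ 2 * C * C + 2 * C * C := by
      obtain ⟨a1, a2, a3, -⟩ := hC r s hr.le hs
      obtain ⟨b1, b2, b3, -⟩ := hC r t hr.le ht
      exact (abs_inner_le_mul (hsub a1 b1) (hhalf a2 b2)).trans (by nlinarith)
    have hfB' (r : ℝ) (hr : 0 < r) : |f' r| ≤ 2 * C * C + 2 * C * C := by
      obtain ⟨a1, a2, a3, -⟩ := hC r s hr.le hs
      obtain ⟨b1, b2, b3, -⟩ := hC r t hr.le ht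
      exact (abs_add_le _ _).trans
        (add_le_add (abs_inner_le_mul (hsub a1 b1) (hhalf a3 b3))
          (abs_inner_le_mul (hsub a2 b2) (hhalf a2 b2)))
    have hibp := integral_deriv_Tpsi_mul_add hd hl hρ hder hfB hfB'
    have hcont : Continuous f := continuous_iff_continuousAt.2 fun r => (hder r).continuousAt
    have hmeas : Measurable f' := by
      rw [← funext fun r => (hder r).deriv]
      exact measurable_deriv f
    have hInt := integrableOn_deriv_Tpsi_mul_add hd hl hρ hcont.aestronglyMeasurable
      hmeas.aestronglyMeasurable hfB hfB'
    have hsum := integral_sub ((hkin hs).sub (hkin ht)) hInt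
    rw [hibp, sub_zero] at hsum
    simp only [Pi.sub_apply] at hsum
    rw [slope_def_module, ← integral_sub (hkin hs) (hkin ht), ← hsum, smul_eq_mul,
      ← integral_const_mul]
    refine setIntegral_congr_fun measurableSet_Ioi fun r _ => ?_
    simp only [hf, hf', slope_def_module, inner_smul_left, inner_smul_right, inner_sub_left,
      inner_add_right, ← real_inner_self_eq_norm_sq, real_inner_comm (ur u r s) (ur u r t),
      conj_trivial]
    ring
  refine Tendsto.congr' hslope ?_
  refine tendsto_integral_filter_of_dominated_convergence
    (fun r => ((((d : ℝ) - 1) / rsc d l + 1) * (C * C) + C * C) *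
      Real.exp (-(kappa0 l) * (r - ρ))) ?_ ?_
    (integrableOn_const_mul_exp (kappa0_pos hl) ρ _) ?_
  · filter_upwards [hpos] with s ⟨hs, _⟩
    have h1 : Continuous fun r => slope (fun s => u r s) t s := by
      simp only [slope_def_module]
      exact ((hu.continuous_space hs).sub (hu.continuous_space ht)).const_smul (s - t)⁻¹
    have h2 := ((hu.continuous_ur hs).add (hu.continuous_ur ht)).const_smul (1 / 2 : ℝ)
    have h3 := ((hu.cont_rr s hs).add (hu.cont_rr t ht)).const_smul (1 / 2 : ℝ)
    exact ((((measurable_deriv _).aestronglyMeasurable.mul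
      (h1.inner h2).aestronglyMeasurable)).add ((continuous_Tpsi hd l ρ).aestronglyMeasurable.mul
      (h1.inner h3).aestronglyMeasurable)).neg
  · filter_upwards [hpos] with s ⟨hs, hst⟩
    filter_upwards [ae_restrict_Ioi_avoid (rsc d l) ρ] with r ⟨hr, hr1, hr2⟩
    obtain ⟨a1, a2, a3, -⟩ := hC r s hr.le hs
    obtain ⟨b1, b2, b3, -⟩ := hC r t hr.le ht
    have hsl := hu.norm_slope_time_le (fun r t hr ht => (hC r t hr ht).2.2.2) hr.le hs ht hst
    rw [Real.norm_eq_abs, abs_neg]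
    exact abs_deriv_Tpsi_mul_add_le hd hl hρ hr hr1 hr2 (abs_inner_le_mul hsl (hhalf a2 b2))
      (abs_inner_le_mul hsl (hhalf a3 b3))
  · filter_upwards [ae_restrict_mem measurableSet_Ioi] with r hr
    have hr : 0 < r := hr
    have hsl := hasDerivAt_iff_tendsto_slope.1 (hu.hasDerivAt_time ht r)
    have havg {g : ℝ → Euc n} (hg : ContinuousAt g t) :
        Tendsto (fun s => (1 / 2 : ℝ) • (g s + g t)) (𝓝[≠] t) (𝓝 (g t)) := by
      have h := ((hg.tendsto.mono_left (nhdsWithin_le_nhds (s := {t}ᶜ))).add_const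
        (g t)).const_smul (1 / 2 : ℝ)
      rwa [← two_smul ℝ (g t), smul_smul, show (1 / 2 : ℝ) * 2 = 1 by norm_num, one_smul] at h
    exact (((hsl.inner (havg (hu.continuousAt_ur_time hr.le ht))).const_mul _).add
      ((hsl.inner (havg (hu.continuousAt_urr_time hV hr ht))).const_mul _)).neg

/-- Time derivative of the part of the firewall which does not involve `u_r`. -/
theorem hasDerivAt_integral_potential (hu : IsRadialSolution d V u) (hV : ContDiff ℝ 2 V)
    (hd : 2 ≤ d) {l : ℝ} (hl : 0 < l) {ρ : ℝ} (hρ : rsc d l ≤ ρ) (w : ℝ) {t : ℝ}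
    (ht : 0 < t) :
    (∀ s > 0, IntegrableOn
      (fun r => Tpsi d l ρ r * (w * V (u r s) + ‖u r s‖ ^ 2 / 2)) (Ioi 0)) ∧
    IntegrableOn (fun r => Tpsi d l ρ r *
      (w * ⟪gradient V (u r t), ut u r t⟫ + ⟪u r t, ut u r t⟫)) (Ioi 0) ∧
    HasDerivAt (fun s => ∫ r in Ioi 0, Tpsi d l ρ r * (w * V (u r s) + ‖u r s‖ ^ 2 / 2))
      (∫ r in Ioi 0, Tpsi d l ρ r *
        (w * ⟪gradient V (u r t), ut u r t⟫ + ⟪u r t, ut u r t⟫)) t := by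
  obtain ⟨C, hC0, hC⟩ := hu.exists_bound
  have hg := (contDiff_gradient hV).continuous
  have hVd : Differentiable ℝ V := hV.differentiable (by norm_num)
  obtain ⟨A, hA⟩ := (isCompact_closedBall (0 : Euc n) C).exists_bound_of_continuousOn
    (f := fun x => w * V x + ‖x‖ ^ 2 / 2)
    (by have := hV.continuous; fun_prop)
  obtain ⟨G, hG⟩ := (isCompact_closedBall (0 : Euc n) C).exists_bound_of_continuousOn
    (f := fun x => w • gradient V x + x) (by fun_prop)
  have hmem {r s : ℝ} (hr : 0 < r) (hs : 0 < s) : u r s ∈ Metric.closedBall (0 : Euc n) C := by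
    simpa using (hC r s hr.le hs).1
  have hInt (s : ℝ) (hs : 0 < s) : IntegrableOn
      (fun r => Tpsi d l ρ r * (w * V (u r s) + ‖u r s‖ ^ 2 / 2)) (Ioi 0) := by
    refine integrableOn_Tpsi_mul hd hl hρ (B := A) (Continuous.aestronglyMeasurable ?_)
      fun r hr => hA _ (hmem hr hs)
    have h1 := hV.continuous.comp (hu.continuous_space hs)
    exact (h1.const_smul w).add (((hu.continuous_space hs).norm.pow 2).div_const 2)
  have hbound {r s : ℝ} (hr : 0 < r) (hs : 0 < s) :
      |w * ⟪gradient V (u r s), ut u r s⟫ + ⟪u r s, ut u r s⟫| ≤ G * C := by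
    rw [← real_inner_smul_left, ← inner_add_left]
    exact abs_inner_le_mul (hG _ (hmem hr hs)) (hC r s hr.le hs).2.2.2
  refine ⟨hInt, hasDerivAt_integral_of_dominated_loc_of_deriv_le
    (μ := volume.restrict (Ioi 0))
    (F := fun s r => Tpsi d l ρ r * (w * V (u r s) + ‖u r s‖ ^ 2 / 2))
    (F' := fun s r => Tpsi d l ρ r *
      (w * ⟪gradient V (u r s), ut u r s⟫ + ⟪u r s, ut u r s⟫))
    (bound := fun r => Tpsi d l ρ r * (G * C)) (Ioi_mem_nhds ht) ?_ (hInt t ht) ?_ ?_ ?_ ?_⟩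
  · filter_upwards [Ioi_mem_nhds ht] with s hs using (hInt s hs).aestronglyMeasurable
  · have h1 := hu.aestronglyMeasurable_ut hV ht
    have h2 := (hg.comp (hu.continuous_space ht)).aestronglyMeasurable
      (μ := volume.restrict (Ioi (0 : ℝ)))
    have h3 := (hu.continuous_space ht).aestronglyMeasurable (μ := volume.restrict (Ioi (0 : ℝ)))
    exact (continuous_Tpsi hd l ρ).aestronglyMeasurable.mul
      (((h2.inner h1).const_mul w).add (h3.inner h1))
  · filter_upwards [ae_restrict_mem measurableSet_Ioi] with r hr s hs
    have hr : 0 < r := hr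
    rw [norm_mul, Real.norm_eq_abs, abs_of_nonneg (Tpsi_nonneg hd l ρ hr.le)]
    exact mul_le_mul_of_nonneg_left (hbound hr hs) (Tpsi_nonneg hd l ρ hr.le)
  · exact integrableOn_Tpsi_mul hd hl hρ aestronglyMeasurable_const fun r _ => le_rfl
  · filter_upwards with r s hs
    have hs : 0 < s := hs
    have h1 := (hasDerivAt_comp_gradient hVd (hu.hasDerivAt_time hs r)).const_mul w
    have h2 := ((hu.hasDerivAt_time hs r).norm_sq).div_const 2
    have h3 := (h1.add h2).const_mul (Tpsi d l ρ r)
    rwa [mul_div_cancel_left₀ _ (two_ne_zero' ℝ)] at h3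

end IsRadialSolution

/-! ### The differential inequality -/

theorem wV_pos (V : Euc n → ℝ) : 0 < wV V :=
  one_div_pos.2 (lt_of_lt_of_le one_pos (le_max_left _ _))

theorem wV_le_one (V : Euc n → ℝ) : wV V ≤ 1 :=
  div_le_one_of_le₀ (le_max_left _ _) (one_pos.le.trans (le_max_left _ _))

/-- Pointwise estimate of the integrand of the time derivative of the firewall. Here `x`, `v`,
`a`, `g` and `q` stand for `u`, `u_r`, `u_t`, `∇V(u)` and `u_rr`. -/
theorem dissipation_integrand_le {x v a g q : Euc n} {b ψ ψ' w l : ℝ}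
    (hpde : a = -g + b • v + q) (hψ : 0 ≤ ψ) (hw : 0 ≤ w) (hw1 : w ≤ 1) (hl : 0 < l)
    (hψ' : |b * ψ - ψ'| ≤ min 1 (l / 4) * ψ) :
    w * -(ψ' * ⟪a, v⟫ + ψ * ⟪a, q⟫) + ψ * (w * ⟪g, a⟫ + ⟪x, a⟫) -
        (ψ' * ⟪x, v⟫ + ψ * (⟪x, q⟫ + ⟪v, v⟫)) ≤
      ψ * (-(‖v‖ ^ 2 / 2) - ⟪x, g⟫ + l / 4 * ‖x‖ ^ 2) := by
  have hq : q = a + g - b • v := by rw [hpde]; abel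
  have hrw : w * -(ψ' * ⟪a, v⟫ + ψ * ⟪a, q⟫) + ψ * (w * ⟪g, a⟫ + ⟪x, a⟫) -
        (ψ' * ⟪x, v⟫ + ψ * (⟪x, q⟫ + ⟪v, v⟫)) =
      -(w * ψ * ‖a‖ ^ 2) + w * ((b * ψ - ψ') * ⟪a, v⟫) + (b * ψ - ψ') * ⟪x, v⟫ -
        ψ * ‖v‖ ^ 2 - ψ * ⟪x, g⟫ := by
    rw [hq]
    simp only [inner_sub_right, inner_add_right, real_inner_smul_right,
      real_inner_self_eq_norm_sq, real_inner_comm a g]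
    ring
  rw [hrw]
  set m := min 1 (l / 4)
  have hm0 : 0 ≤ m := le_min one_pos.le (by linarith)
  have hm1 : m ≤ 1 := min_le_left _ _
  have hml : m ≤ l / 4 := min_le_right _ _
  have hmul (y : Euc n) : (b * ψ - ψ') * ⟪y, v⟫ ≤ ψ * (m * (‖y‖ * ‖v‖)) := by
    refine (le_abs_self _).trans ?_
    rw [abs_mul]
    refine (mul_le_mul hψ' (abs_real_inner_le_norm y v) (abs_nonneg _) (by positivity)).trans ?_
    exact le_of_eq (by ring)
  have ha : m * (‖a‖ * ‖v‖) ≤ ‖a‖ ^ 2 + ‖v‖ ^ 2 / 4 := by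
    have : m * (‖a‖ * ‖v‖) ≤ ‖a‖ * ‖v‖ := mul_le_of_le_one_left (by positivity) hm1
    nlinarith [sq_nonneg (‖a‖ - ‖v‖ / 2)]
  have hx : m * (‖x‖ * ‖v‖) ≤ l / 4 * ‖x‖ ^ 2 + ‖v‖ ^ 2 / 4 := by
    have h1 : m ^ 2 ≤ l / 4 := by nlinarith
    have h2 : m ^ 2 * ‖x‖ ^ 2 ≤ l / 4 * ‖x‖ ^ 2 := by gcongr
    nlinarith [sq_nonneg (m * ‖x‖ - ‖v‖ / 2)]
  have h1 := mul_le_mul_of_nonneg_left ((hmul a).trans (mul_le_mul_of_nonneg_left ha hψ)) hw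
  have h2 := (hmul x).trans (mul_le_mul_of_nonneg_left hx hψ)
  have h3 : w * (ψ * (‖v‖ ^ 2 / 4)) ≤ ψ * (‖v‖ ^ 2 / 4) :=
    mul_le_of_le_one_left (by positivity) hw1
  nlinarith

/-- The reaction term controls the firewall up to a pollution term. -/
theorem exists_pollution_bound {V : Euc n → ℝ} (hV : ContDiff ℝ 2 V) (D : EscData n V)
    (h0 : (0 : Euc n) ∈ MinSet V) (hV0 : V 0 = 0) (R : ℝ) {w : ℝ} (hw : 0 ≤ w) (hw1 : w ≤ 1) :
    ∃ K > 0, ∀ x : Euc n, ‖x‖ ≤ R →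
      -⟪x, gradient V x⟫ + D.lmin / 4 * ‖x‖ ^ 2 +
        D.lmin / (2 * (D.lmin + 1)) * (w * V x + ‖x‖ ^ 2 / 2) ≤
      if D.dEsc < ‖x‖ then K else 0 := by
  have hg := (contDiff_gradient hV).continuous
  have hVc := hV.continuous
  have hl := D.lmin_pos
  obtain ⟨K, hK⟩ := (isCompact_closedBall (0 : Euc n) R).exists_bound_of_continuousOn
    (f := fun x => -⟪x, gradient V x⟫ + D.lmin / 4 * ‖x‖ ^ 2 +
        D.lmin / (2 * (D.lmin + 1)) * (w * V x + ‖x‖ ^ 2 / 2))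
    (Continuous.continuousOn (by fun_prop))
  refine ⟨max K 1, lt_max_of_lt_right one_pos, fun x hx => ?_⟩
  split_ifs with h
  · exact (le_abs_self _).trans ((hK x (by simpa using hx)).trans (le_max_left _ _))
  · obtain ⟨h1, h2⟩ := convexity_estimates hV D h0 hV0 (not_lt.1 h)
    have hnn : 0 ≤ ⟪x, gradient V x⟫ := le_trans (by positivity) h1
    have h3 : w * V x ≤ ⟪x, gradient V x⟫ :=
      (mul_le_mul_of_nonneg_left h2 hw).trans (mul_le_of_le_one_left hnn hw1)
    have h4 : D.lmin / (2 * (D.lmin + 1)) * (w * V x + ‖x‖ ^ 2 / 2) ≤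
        ⟪x, gradient V x⟫ / 2 := by
      rw [div_mul_eq_mul_div, div_le_iff₀ (by positivity)]
      nlinarith
    linarith

namespace IsRadialSolution

variable {d : ℕ} {V : Euc n → ℝ} {u : ℝ → ℝ → Euc n}

theorem integrableOn_kinetic_deriv (hu : IsRadialSolution d V u) (hV : ContDiff ℝ 2 V)
    (hd : 2 ≤ d) {l : ℝ} (hl : 0 < l) {ρ : ℝ} (hρ : rsc d l ≤ ρ) {t : ℝ} (ht : 0 < t) :
    IntegrableOn (fun r => -(deriv (Tpsi d l ρ) r * ⟪ut u r t, ur u r t⟫ +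
      Tpsi d l ρ r * ⟪ut u r t, urr u r t⟫)) (Ioi 0) := by
  obtain ⟨C, hC0, hC⟩ := hu.exists_bound
  have h1 := hu.aestronglyMeasurable_ut hV ht
  refine (integrableOn_deriv_Tpsi_mul_add hd hl hρ (B := C * C)
    (h1.inner (hu.continuous_ur ht).aestronglyMeasurable)
    (h1.inner (hu.cont_rr t ht).aestronglyMeasurable) ?_ ?_).neg <;> intro r hr
  · exact abs_inner_le_mul (hC r t hr.le ht).2.2.2 (hC r t hr.le ht).2.1
  · exact abs_inner_le_mul (hC r t hr.le ht).2.2.2 (hC r t hr.le ht).2.2.1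

/-- Integration by parts for the diffusion term of the squared norm. -/
theorem integral_diffusion_eq_zero (hu : IsRadialSolution d V u) (hd : 2 ≤ d) {l : ℝ}
    (hl : 0 < l) {ρ : ℝ} (hρ : rsc d l ≤ ρ) {t : ℝ} (ht : 0 < t) :
    IntegrableOn (fun r => deriv (Tpsi d l ρ) r * ⟪u r t, ur u r t⟫ +
      Tpsi d l ρ r * (⟪u r t, urr u r t⟫ + ⟪ur u r t, ur u r t⟫)) (Ioi 0) ∧
    ∫ r in Ioi 0, (deriv (Tpsi d l ρ) r * ⟪u r t, ur u r t⟫ +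
      Tpsi d l ρ r * (⟪u r t, urr u r t⟫ + ⟪ur u r t, ur u r t⟫)) = 0 := by
  obtain ⟨C, hC0, hC⟩ := hu.exists_bound
  have hB (r : ℝ) (hr : 0 < r) : |⟪u r t, ur u r t⟫| ≤ C * C + C * C :=
    (abs_inner_le_mul (hC r t hr.le ht).1 (hC r t hr.le ht).2.1).trans (by nlinarith)
  have hB' (r : ℝ) (hr : 0 < r) :
      |⟪u r t, urr u r t⟫ + ⟪ur u r t, ur u r t⟫| ≤ C * C + C * C :=
    (abs_add_le _ _).trans (add_le_add
      (abs_inner_le_mul (hC r t hr.le ht).1 (hC r t hr.le ht).2.2.1)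
      (abs_inner_le_mul (hC r t hr.le ht).2.1 (hC r t hr.le ht).2.1))
  have h1 := hu.continuous_space ht
  have h2 := hu.continuous_ur ht
  exact ⟨integrableOn_deriv_Tpsi_mul_add hd hl hρ (h1.inner h2).aestronglyMeasurable
      ((h1.inner (hu.cont_rr t ht)).add (h2.inner h2)).aestronglyMeasurable hB hB',
    integral_deriv_Tpsi_mul_add hd hl hρ
      (fun r => (hu.hasDerivAt_space ht r).inner ℝ (hu.hasDerivAt_ur ht r)) hB hB'⟩

theorem integral_Sigma0_eq (hu : IsRadialSolution d V u) {t : ℝ} (ht : 0 < t) (δ : ℝ)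
    (f : ℝ → ℝ) :
    MeasurableSet (Sigma0 u δ t) ∧
      ∫ r in Ioi 0, (Sigma0 u δ t).indicator f r = ∫ r in Sigma0 u δ t, f r := by
  have hmeas : MeasurableSet (Sigma0 u δ t) :=
    measurableSet_Ici.inter
      (isOpen_lt continuous_const (hu.continuous_space ht).norm).measurableSet
  refine ⟨hmeas, ?_⟩
  rw [setIntegral_indicator hmeas]
  refine setIntegral_congr_set ?_
  have hsub : (Ici 0 ∩ Sigma0 u δ t : Set ℝ) = Sigma0 u δ t :=
    inter_eq_right.2 fun r hr => hr.1
  exact (Ioi_ae_eq_Ici.inter (ae_eq_refl _)).trans (Filter.EventuallyEq.of_eq hsub)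

/-- The firewall inequality, given a bound on the reaction term. -/
theorem fireIneq (hu : IsRadialSolution d V u) (hV : ContDiff ℝ 2 V) (hd : 2 ≤ d)
    {l δ ν K R : ℝ} (hl : 0 < l) (hν1 : ν ≤ 1)
    (hR : ∀ r t : ℝ, 0 ≤ r → 0 ≤ t → ‖u r t‖ ≤ R)
    (hK : ∀ x : Euc n, ‖x‖ ≤ R →
      -⟪x, gradient V x⟫ + l / 4 * ‖x‖ ^ 2 + ν * (wV V * V x + ‖x‖ ^ 2 / 2) ≤
        if δ < ‖x‖ then K else 0) :
    FireIneq V d l δ u ν K := by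
  intro ρ hρ t ht
  have hw := (wV_pos V).le
  have hw1 := wV_le_one V
  obtain ⟨hPint, hPint', hP⟩ := hu.hasDerivAt_integral_potential hV hd hl hρ (wV V) ht
  have hA := hu.hasDerivAt_integral_kinetic hV hd hl hρ ht
  have hAint (s : ℝ) (hs : 0 < s) :=
    (hu.integrableOn_kinetic hd hl hρ hs).integrable.const_mul (wV V)
  have hAint' := (hu.integrableOn_kinetic_deriv hV hd hl hρ ht).integrable.const_mul (wV V)
  obtain ⟨hIint, hI⟩ := hu.integral_diffusion_eq_zero hd hl hρ ht
  have hsplit (s r : ℝ) :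
      Tpsi d l ρ r * (wV V * (‖ur u r s‖ ^ 2 / 2 + V (u r s)) + ‖u r s‖ ^ 2 / 2) =
      wV V * (Tpsi d l ρ r * (‖ur u r s‖ ^ 2 / 2)) +
        Tpsi d l ρ r * (wV V * V (u r s) + ‖u r s‖ ^ 2 / 2) := by ring
  have hF : (fun s => F0 V d l u ρ s) =ᶠ[𝓝 t] fun s =>
      wV V * (∫ r in Ioi 0, Tpsi d l ρ r * (‖ur u r s‖ ^ 2 / 2)) +
        ∫ r in Ioi 0, Tpsi d l ρ r * (wV V * V (u r s) + ‖u r s‖ ^ 2 / 2) := by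
    filter_upwards [Ioi_mem_nhds ht] with s hs
    simp only [F0, hsplit]
    rw [integral_add (hAint s hs) (hPint s hs), integral_const_mul]
  have hder := ((hA.const_mul (wV V)).add hP).congr_of_eventuallyEq hF
  refine ⟨hder.differentiableAt, ?_⟩
  obtain ⟨hSig, hSigInt⟩ := hu.integral_Sigma0_eq ht δ (Tpsi d l ρ)
  have hFint : IntegrableOn (fun r => Tpsi d l ρ r *
      (wV V * (‖ur u r t‖ ^ 2 / 2 + V (u r t)) + ‖u r t‖ ^ 2 / 2)) (Ioi 0) := by
    simp only [hsplit]
    exact (hAint t ht).add (hPint t ht)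
  have hψint : IntegrableOn (Tpsi d l ρ) (Ioi 0) := by
    simpa using integrableOn_Tpsi_mul hd hl hρ (g := fun _ => 1) aestronglyMeasurable_const
      (fun _ _ => le_rfl)
  have hSigψ := hψint.integrable.indicator hSig
  have hsub := integral_sub (hAint'.add hPint') hIint
  rw [hI, sub_zero] at hsub
  rw [hder.deriv, ← integral_const_mul, ← integral_add hAint' hPint', ← hSigInt, F0,
    ← integral_const_mul, ← integral_const_mul,
    ← integral_add (hFint.integrable.const_mul _) (hSigψ.const_mul _)]
  refine hsub.symm.le.trans ?_
  refine integral_mono_ae ((hAint'.add hPint').sub hIint)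
    ((hFint.integrable.const_mul _).add (hSigψ.const_mul _)) ?_
  filter_upwards [ae_restrict_Ioi_avoid (rsc d l) ρ] with r ⟨hr, hr1, hr2⟩
  obtain ⟨ψ', hψ', hle⟩ := exists_hasDerivAt_Tpsi hd hl hρ hr hr1 hr2
  have hψ := Tpsi_nonneg hd l ρ hr.le
  have h1 := dissipation_integrand_le (x := u r t) (hu.pde r hr t ht) hψ hw hw1 hl hle
  have h2 := mul_le_mul_of_nonneg_left (hK (u r t) (hR r t hr.le ht.le)) hψ
  have h3 : K * (Sigma0 u δ t).indicator (Tpsi d l ρ) r =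
      Tpsi d l ρ r * (if δ < ‖u r t‖ then K else 0) := by
    by_cases h : δ < ‖u r t‖
    · rw [indicator_of_mem (show r ∈ Sigma0 u δ t from ⟨hr.le, h⟩), if_pos h, mul_comm]
    · rw [indicator_of_notMem (fun h' => h h'.2), if_neg h, mul_zero, mul_zero]
  have h4 : ν * wV V * (Tpsi d l ρ r * (‖ur u r t‖ ^ 2 / 2)) ≤
      Tpsi d l ρ r * (‖ur u r t‖ ^ 2 / 2) :=
    mul_le_of_le_one_left (by positivity) (mul_le_one₀ hν1 hw hw1)
  simp only [Pi.add_apply, hψ'.deriv, h3]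
  refine h1.trans ?_
  linarith

end IsRadialSolution

/-- firewall decrease up to pollution term, laboratory frame. -/
theorem stmt4 {n d k : ℕ} (hn : 1 ≤ n) (hd : 2 ≤ d) (hk : 2 ≤ k)
    (V : Euc n → ℝ) (hV : ContDiff ℝ (k : ℕ∞) V) (hcoerc : HCoerc V)
    (D : EscData n V) (h0 : (0 : Euc n) ∈ MinSet V) (hV0 : V 0 = 0)
    (R : ℝ) :
    ∃ ν > (0:ℝ), ∃ K > (0:ℝ),
      ∀ u : ℝ → ℝ → Euc n, IsRadialSolution d V u →
        (∀ r t : ℝ, 0 ≤ r → 0 ≤ t → ‖u r t‖ ≤ R) →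
        FireIneq V d D.lmin D.dEsc u ν K := by
  have hV2 : ContDiff ℝ 2 V := by
    refine hV.of_le ?_
    have h2 : (2 : ℕ∞) ≤ k := by exact_mod_cast hk
    exact WithTop.coe_le_coe.2 h2
  have hl := D.lmin_pos
  obtain ⟨K, hK0, hK⟩ := exists_pollution_bound hV2 D h0 hV0 R (wV_pos V).le (wV_le_one V)
  refine ⟨D.lmin / (2 * (D.lmin + 1)), by positivity, K, hK0, fun u hu hR => ?_⟩
  refine hu.fireIneq hV2 hd hl ?_ hR hK
  rw [div_le_one (by positivity)]
  linarith
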